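/- arXiv:0802.0223 — 2 statements merged into one kernel-verified Lean document; each statement's English description precedes it below -/
import Mathlib

section
/- Let p ≥ 1 be an integer, Ω a p×p real symmetric positive definite matrix, φ a real number, and p₀ > 0. Define P₀ = p₀ I_p and, for t ≥ 1, P_t = R_t (R_t + I_p)^{-1} with R_t = φ² P_{t-1} + Ω. Then the sequence of symmetric positive definite matrices {P_t} is convergent (entrywise). -/
open Matrix Filter

lemma riccati_scalar_conv (a w x0 : ℝ) (ha : 0 ≤ a) (hw : 0 < w) (hx0 : 0 < x0) (x : ℕ → ℝ)
    (h0 : x 0 = x0) (hr : ∀ t, x (t + 1) = (a * x t + w) / (a * x t + w + 1)) :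
    (∀ t, 0 < x t) ∧ ∃ l, Tendsto x atTop (nhds l) := by
  have hpos : ∀ t, 0 < x t := by
    intro t
    induction t with
    | zero => rw [h0]; exact hx0
    | succ t ih => rw [hr]; positivity
  refine ⟨hpos, ?_⟩
  have hmono : ∀ u v, 0 < u → 0 < v → u ≤ v →
      (a * u + w) / (a * u + w + 1) ≤ (a * v + w) / (a * v + w + 1) := by
    intro u v hu hv huv
    have := mul_le_mul_of_nonneg_left huv ha
    rw [div_le_div_iff₀ (by positivity) (by positivity)]
    nlinarith
  rcases le_total (x 0) (x 1) with h | h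
  · have hm : Monotone x := by
      refine monotone_nat_of_le_succ fun n => ?_
      induction n with
      | zero => exact h
      | succ n ih => rw [hr n, hr (n + 1)]; exact hmono _ _ (hpos _) (hpos _) ih
    refine ⟨_, tendsto_atTop_ciSup hm ⟨1, ?_⟩⟩
    rintro _ ⟨t, rfl⟩
    refine (hm (Nat.le_succ t)).trans ?_
    have := mul_nonneg ha (hpos t).le
    show x (t + 1) ≤ 1
    rw [hr, div_le_one (by positivity)]
    linarith
  · have hm : Antitone x := by
      refine antitone_nat_of_succ_le fun n => ?_
      induction n with
      | zero => exact h
      | succ n ih => rw [hr n, hr (n + 1)]; exact hmono _ _ (hpos _) (hpos _) ih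
    refine ⟨_, tendsto_atTop_ciInf hm ⟨0, ?_⟩⟩
    rintro _ ⟨t, rfl⟩
    exact (hpos t).le

/-- The Riccati-type recursion `P₀ = p₀ I`, `P_t = R_t (R_t + I)⁻¹` with
`R_t = φ² P_{t-1} + Ω` produces a sequence of symmetric positive definite matrices which is
convergent (entrywise). -/
theorem riccati_convergent (p : ℕ) (hp : 1 ≤ p)
    (Ω : Matrix (Fin p) (Fin p) ℝ) (hΩ : Ω.PosDef)
    (φ p₀ : ℝ) (hp₀ : 0 < p₀)
    (P : ℕ → Matrix (Fin p) (Fin p) ℝ)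
    (hP0 : P 0 = p₀ • (1 : Matrix (Fin p) (Fin p) ℝ))
    (hPrec : ∀ t : ℕ, P (t + 1) = (φ ^ 2 • P t + Ω) * (φ ^ 2 • P t + Ω + 1)⁻¹) :
    (∀ t : ℕ, (P t).PosDef) ∧ ∃ L : Matrix (Fin p) (Fin p) ℝ, Tendsto P atTop (nhds L) := by
  obtain ⟨U, V, d, hUV, hVU, hV, hd, hs⟩ : ∃ (U V : Matrix (Fin p) (Fin p) ℝ) (d : Fin p → ℝ),
      U * V = 1 ∧ V * U = 1 ∧ V = Uᴴ ∧ (∀ i, 0 < d i) ∧ Ω = U * diagonal d * V := by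
    refine ⟨hΩ.isHermitian.eigenvectorUnitary, star hΩ.isHermitian.eigenvectorUnitary,
      hΩ.isHermitian.eigenvalues, ?_, ?_, rfl, hΩ.eigenvalues_pos, ?_⟩
    · exact Unitary.coe_mul_star_self _
    · exact Unitary.coe_star_mul_self _
    · exact hΩ.isHermitian.spectral_theorem
  have hmul : ∀ e f : Fin p → ℝ, (U * diagonal e * V) * (U * diagonal f * V)
      = U * diagonal (fun i => e i * f i) * V := by
    intro e f
    rw [← diagonal_mul_diagonal]
    calc _ = U * diagonal e * (V * U) * diagonal f * V := by simp only [Matrix.mul_assoc]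
      _ = _ := by rw [hVU]; simp only [Matrix.mul_assoc, Matrix.one_mul]
  have hone : ∀ c : ℝ, U * diagonal (fun _ : Fin p => c) * V = c • 1 := by
    intro c
    rw [← smul_one_eq_diagonal]
    simp [hUV]
  have hadd : ∀ e f : Fin p → ℝ, U * diagonal e * V + U * diagonal f * V
      = U * diagonal (fun i => e i + f i) * V := by
    intro e f
    rw [← diagonal_add, Matrix.mul_add, Matrix.add_mul]
  have hsm : ∀ (c : ℝ) (e : Fin p → ℝ), c • (U * diagonal e * V)
      = U * diagonal (fun i => c * e i) * V := by
    intro c e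
    have : diagonal (fun i => c * e i) = c • diagonal e := by
      rw [← diagonal_smul]; rfl
    rw [this]; simp
  let x : Fin p → ℕ → ℝ := fun i t =>
    Nat.rec p₀ (fun _ y => (φ ^ 2 * y + d i) / (φ ^ 2 * y + d i + 1)) t
  have hx : ∀ i, (∀ t, 0 < x i t) ∧ ∃ l, Tendsto (x i) atTop (nhds l) := fun i =>
    riccati_scalar_conv (φ ^ 2) (d i) p₀ (sq_nonneg _) (hd i) hp₀ (x i) rfl (fun _ => rfl)
  have hP : ∀ t, P t = U * diagonal (fun i => x i t) * V := by
    intro t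
    induction t with
    | zero => rw [hP0]; exact (hone p₀).symm
    | succ t ih =>
      have h1 : (1 : Matrix (Fin p) (Fin p) ℝ) = U * diagonal (fun _ => 1) * V := by
        rw [hone, one_smul]
      have hR : φ ^ 2 • P t + Ω = U * diagonal (fun i => φ ^ 2 * x i t + d i) * V := by
        rw [ih, hs, hsm, hadd]
      have hinv : (φ ^ 2 • P t + Ω + 1)⁻¹
          = U * diagonal (fun i => (φ ^ 2 * x i t + d i + 1)⁻¹) * V := by
        apply Matrix.inv_eq_right_inv
        rw [hR]
        nth_rewrite 1 [h1]
        rw [hadd, hmul, h1]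
        congr 3
        funext i
        have := (hx i).1 t
        have := hd i
        exact mul_inv_cancel₀ (by positivity)
      rw [hPrec, hinv, hR, hmul]
      rfl
  constructor
  · intro t
    rw [hP t, hV]
    have hD : (diagonal (fun i => x i t)).PosDef := PosDef.diagonal fun i => (hx i).1 t
    refine hD.mul_mul_conjTranspose_same ?_
    intro u v huv
    have := congrArg (fun z => z ᵥ* V) huv
    simpa [hUV] using this
  · choose l hl using fun i => (hx i).2
    refine ⟨U * diagonal l * V, ?_⟩
    rw [show P = fun t => U * diagonal (fun i => x i t) * V from funext hP]
    have hc : Continuous fun y : Fin p → ℝ => U * diagonal y * V := by fun_prop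
    exact (hc.tendsto l).comp (tendsto_pi_nhds.2 hl)
end

section
/- Let p ≥ 1 be an integer, Ω a p×p real symmetric positive definite matrix, φ a real number, and p₀ > 0. Define P₀ = p₀ I_p and, for t ≥ 1, P_t = R_t (R_t + I_p)^{-1} with R_t = φ² P_{t-1} + Ω. Then every P_t commutes with Ω, and the limit matrix P = lim_{t→∞} P_t commutes with Ω: PΩ = ΩP. -/
open Matrix Filter

/-- Every iterate of the Riccati-type recursion `P₀ = p₀ I`, `P_t = R_t (R_t + I)⁻¹`,
`R_t = φ² P_{t-1} + Ω` commutes with `Ω`, and so does the limit matrix. -/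
theorem riccati_commutes (p : ℕ) (hp : 1 ≤ p)
    (Ω : Matrix (Fin p) (Fin p) ℝ) (hΩ : Ω.PosDef)
    (φ p₀ : ℝ) (hp₀ : 0 < p₀)
    (P : ℕ → Matrix (Fin p) (Fin p) ℝ)
    (hP0 : P 0 = p₀ • (1 : Matrix (Fin p) (Fin p) ℝ))
    (hPrec : ∀ t : ℕ, P (t + 1) = (φ ^ 2 • P t + Ω) * (φ ^ 2 • P t + Ω + 1)⁻¹) :
    (∀ t : ℕ, P t * Ω = Ω * P t) ∧
      ∀ L : Matrix (Fin p) (Fin p) ℝ, Tendsto P atTop (nhds L) → L * Ω = Ω * L := by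
  have key : ∀ t : ℕ, P t * Ω = Ω * P t := by
    intro t
    induction t with
    | zero => rw [hP0]; simp
    | succ t ih =>
      have hR : Commute (φ ^ 2 • P t + Ω) Ω :=
        Commute.add_left (Commute.smul_left ih _) (Commute.refl Ω)
      have hS : Commute (φ ^ 2 • P t + Ω + 1) Ω := hR.add_left (Commute.one_left Ω)
      have hI : Commute (φ ^ 2 • P t + Ω + 1)⁻¹ Ω := by
        generalize φ ^ 2 • P t + Ω + 1 = S at hS
        by_cases h : IsUnit S.det
        · have h1 := Matrix.nonsing_inv_mul S h
          have h2 := Matrix.mul_nonsing_inv S h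
          have hS' : S * Ω = Ω * S := hS
          change S⁻¹ * Ω = Ω * S⁻¹
          calc S⁻¹ * Ω = S⁻¹ * (Ω * S) * S⁻¹ := by
                rw [Matrix.mul_assoc, Matrix.mul_assoc, h2, Matrix.mul_one]
            _ = Ω * S⁻¹ := by
                rw [← hS', ← Matrix.mul_assoc, h1, Matrix.one_mul]
        · rw [Matrix.nonsing_inv_apply_not_isUnit S h]
          exact Commute.zero_left Ω
      rw [hPrec]
      exact hR.mul_left hI
  refine ⟨key, fun L hL => ?_⟩
  have h1 : Tendsto (fun t => P t * Ω) atTop (nhds (L * Ω)) :=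
    ((continuous_id.matrix_mul continuous_const).tendsto L).comp hL
  have h2 : Tendsto (fun t => Ω * P t) atTop (nhds (Ω * L)) :=
    ((continuous_const.matrix_mul continuous_id).tendsto L).comp hL
  simp only [key] at h1
  exact tendsto_nhds_unique h1 h2
end
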